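/- For every 2-player stage game G: G ∉ 𝒢_LS^{p,p} and G ∈ 𝒢_LS^{m,m} if and only if at least one of the following holds: (1) |V₁^{p,p}| = 0, |V₂^{p,p}| = 0, and the mixed-mixed characterization condition holds for G; OR (2) |V₁^{p,p}| = 1, |V₂^{p,p}| = 1, and the mixed-mixed characterization condition holds for G; OR (3) |V₁^{p,p}| > 1, |V₂^{p,p}| = 1, the pure-pure characterization condition does not hold for G, and the mixed-mixed characterization condition holds for G; OR (4) |V₁^{p,p}| = 1, |V₂^{p,p}| > 1, the pure-pure characterization condition does not hold for G, and the mixed-mixed characterization condition holds for G. -/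

import Mathlib

open Finset

/-- A mixed strategy on a finite action set: a probability distribution. -/
structure Mix (A : Type*) [Fintype A] where
  p : A → ℝ
  nonneg : ∀ a, 0 ≤ p a
  sum_one : ∑ a, p a = 1

namespace Mix

/-- The Dirac (pure) mixed strategy at an action. -/
def pure {A : Type*} [Fintype A] [DecidableEq A] (a : A) : Mix A where
  p := fun b => if b = a then 1 else 0
  nonneg := by intro b; by_cases hb : b = a <;> simp [hb]
  sum_one := by simp

/-- The support of a mixed strategy. -/
def support {A : Type*} [Fintype A] (σ : Mix A) : Set A := {a | 0 < σ.p a}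

end Mix

section TwoPlayer

variable {A₁ A₂ : Type*} [Fintype A₁] [Fintype A₂] [DecidableEq A₁] [DecidableEq A₂]

/-- Expected payoff under a mixed strategy profile. -/
def expPay (u : A₁ → A₂ → ℝ) (σ₁ : Mix A₁) (σ₂ : Mix A₂) : ℝ :=
  ∑ a₁, ∑ a₂, σ₁.p a₁ * σ₂.p a₂ * u a₁ a₂

/-- Player 1's pure action `a₁` is a best response among pure strategies to `a₂`. -/
def BR1p (u₁ : A₁ → A₂ → ℝ) (a₁ : A₁) (a₂ : A₂) : Prop := ∀ b₁, u₁ b₁ a₂ ≤ u₁ a₁ a₂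

/-- Player 2's pure action `a₂` is a best response among pure strategies to `a₁`. -/
def BR2p (u₂ : A₁ → A₂ → ℝ) (a₁ : A₁) (a₂ : A₂) : Prop := ∀ b₂, u₂ a₁ b₂ ≤ u₂ a₁ a₂

/-- Player 1's mixed strategy `σ₁` is a best response (among mixed strategies) to `σ₂`. -/
def BR1m (u₁ : A₁ → A₂ → ℝ) (σ₁ : Mix A₁) (σ₂ : Mix A₂) : Prop :=
  ∀ τ₁ : Mix A₁, expPay u₁ τ₁ σ₂ ≤ expPay u₁ σ₁ σ₂

/-- Player 2's mixed strategy `σ₂` is a best response (among mixed strategies) to `σ₁`. -/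
def BR2m (u₂ : A₁ → A₂ → ℝ) (σ₁ : Mix A₁) (σ₂ : Mix A₂) : Prop :=
  ∀ τ₂ : Mix A₂, expPay u₂ σ₁ τ₂ ≤ expPay u₂ σ₁ σ₂

/-- Player 2's pure action `a₂` is a best response among pure strategies to mixed `σ₁`. -/
def BR2pm (u₂ : A₁ → A₂ → ℝ) (σ₁ : Mix A₁) (a₂ : A₂) : Prop :=
  ∀ b₂ : A₂, expPay u₂ σ₁ (Mix.pure b₂) ≤ expPay u₂ σ₁ (Mix.pure a₂)

/-- Pure Nash equilibria (both players restricted to pure strategies). -/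
def NashPP (u₁ u₂ : A₁ → A₂ → ℝ) : Set (A₁ × A₂) :=
  {q | BR1p u₁ q.1 q.2 ∧ BR2p u₂ q.1 q.2}

/-- Nash equilibria when player 1 is mixed and player 2 is pure. -/
def NashMP (u₁ u₂ : A₁ → A₂ → ℝ) : Set (Mix A₁ × A₂) :=
  {q | BR1m u₁ q.1 (Mix.pure q.2) ∧ BR2pm u₂ q.1 q.2}

/-- Mixed Nash equilibria. -/
def NashMM (u₁ u₂ : A₁ → A₂ → ℝ) : Set (Mix A₁ × Mix A₂) :=
  {q | BR1m u₁ q.1 q.2 ∧ BR2m u₂ q.1 q.2}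

def V1pp (u₁ u₂ : A₁ → A₂ → ℝ) : Set ℝ := (fun q => u₁ q.1 q.2) '' NashPP u₁ u₂
def V2pp (u₁ u₂ : A₁ → A₂ → ℝ) : Set ℝ := (fun q => u₂ q.1 q.2) '' NashPP u₁ u₂
def V1mp (u₁ u₂ : A₁ → A₂ → ℝ) : Set ℝ :=
  (fun q => expPay u₁ q.1 (Mix.pure q.2)) '' NashMP u₁ u₂
def V2mp (u₁ u₂ : A₁ → A₂ → ℝ) : Set ℝ :=
  (fun q => expPay u₂ q.1 (Mix.pure q.2)) '' NashMP u₁ u₂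
def V1mm (u₁ u₂ : A₁ → A₂ → ℝ) : Set ℝ := (fun q => expPay u₁ q.1 q.2) '' NashMM u₁ u₂
def V2mm (u₁ u₂ : A₁ → A₂ → ℝ) : Set ℝ := (fun q => expPay u₂ q.1 q.2) '' NashMM u₁ u₂

/-- The set `V` is a singleton, i.e. `|V| = 1`. -/
def oneVal (V : Set ℝ) : Prop := ∃ v, V = {v}

/-- A history of play: a finite sequence of pure action profiles. -/
abbrev Hist (A₁ A₂ : Type*) := List (A₁ × A₂)

/-- A pure behavior strategy for player 1, seen as a mixed behavior strategy. -/
def pureBeh1 (μ : Hist A₁ A₂ → A₁) : Hist A₁ A₂ → Mix A₁ := fun h => Mix.pure (μ h)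

/-- A pure behavior strategy for player 2, seen as a mixed behavior strategy. -/
def pureBeh2 (μ : Hist A₁ A₂ → A₂) : Hist A₁ A₂ → Mix A₂ := fun h => Mix.pure (μ h)

/-- Expected total payoff (w.r.t. `u`) over `T` remaining rounds, after history `h`. -/
def totPay (u : A₁ → A₂ → ℝ) (μ₁ : Hist A₁ A₂ → Mix A₁) (μ₂ : Hist A₁ A₂ → Mix A₂) :
    ℕ → Hist A₁ A₂ → ℝ
  | 0, _ => 0
  | T + 1, h =>
      ∑ a₁, ∑ a₂, (μ₁ h).p a₁ * (μ₂ h).p a₂ * (u a₁ a₂ + totPay u μ₁ μ₂ T (h ++ [(a₁, a₂)]))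

/-- The behavior strategy induced on the subgame following history `h`. -/
def condS {A₁ A₂ α : Type*} (μ : Hist A₁ A₂ → α) (h : Hist A₁ A₂) : Hist A₁ A₂ → α :=
  fun h' => μ (h ++ h')

/-- Nash equilibrium of the `T`-round repeated game, both players mixed. -/
def isNEmm (u₁ u₂ : A₁ → A₂ → ℝ) (T : ℕ)
    (μ₁ : Hist A₁ A₂ → Mix A₁) (μ₂ : Hist A₁ A₂ → Mix A₂) : Prop :=
  (∀ μ₁' : Hist A₁ A₂ → Mix A₁, totPay u₁ μ₁' μ₂ T [] ≤ totPay u₁ μ₁ μ₂ T []) ∧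
  (∀ μ₂' : Hist A₁ A₂ → Mix A₂, totPay u₂ μ₁ μ₂' T [] ≤ totPay u₂ μ₁ μ₂ T [])

/-- Subgame-perfect equilibrium of the `T`-round repeated game, both players mixed. -/
def isSPEmm (u₁ u₂ : A₁ → A₂ → ℝ) (T : ℕ)
    (μ₁ : Hist A₁ A₂ → Mix A₁) (μ₂ : Hist A₁ A₂ → Mix A₂) : Prop :=
  ∀ h : Hist A₁ A₂, h.length < T → isNEmm u₁ u₂ (T - h.length) (condS μ₁ h) (condS μ₂ h)

/-- Nash equilibrium of the `T`-round repeated game, player 1 mixed and player 2 pure. -/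
def isNEmp (u₁ u₂ : A₁ → A₂ → ℝ) (T : ℕ)
    (μ₁ : Hist A₁ A₂ → Mix A₁) (μ₂ : Hist A₁ A₂ → A₂) : Prop :=
  (∀ μ₁' : Hist A₁ A₂ → Mix A₁,
      totPay u₁ μ₁' (pureBeh2 μ₂) T [] ≤ totPay u₁ μ₁ (pureBeh2 μ₂) T []) ∧
  (∀ μ₂' : Hist A₁ A₂ → A₂,
      totPay u₂ μ₁ (pureBeh2 μ₂') T [] ≤ totPay u₂ μ₁ (pureBeh2 μ₂) T [])

/-- SPE of the `T`-round repeated game, player 1 mixed and player 2 pure. -/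
def isSPEmp (u₁ u₂ : A₁ → A₂ → ℝ) (T : ℕ)
    (μ₁ : Hist A₁ A₂ → Mix A₁) (μ₂ : Hist A₁ A₂ → A₂) : Prop :=
  ∀ h : Hist A₁ A₂, h.length < T → isNEmp u₁ u₂ (T - h.length) (condS μ₁ h) (condS μ₂ h)

/-- Nash equilibrium of the `T`-round repeated game, both players pure. -/
def isNEpp (u₁ u₂ : A₁ → A₂ → ℝ) (T : ℕ)
    (μ₁ : Hist A₁ A₂ → A₁) (μ₂ : Hist A₁ A₂ → A₂) : Prop :=
  (∀ μ₁' : Hist A₁ A₂ → A₁,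
      totPay u₁ (pureBeh1 μ₁') (pureBeh2 μ₂) T [] ≤
        totPay u₁ (pureBeh1 μ₁) (pureBeh2 μ₂) T []) ∧
  (∀ μ₂' : Hist A₁ A₂ → A₂,
      totPay u₂ (pureBeh1 μ₁) (pureBeh2 μ₂') T [] ≤
        totPay u₂ (pureBeh1 μ₁) (pureBeh2 μ₂) T [])

/-- SPE of the `T`-round repeated game, both players pure. -/
def isSPEpp (u₁ u₂ : A₁ → A₂ → ℝ) (T : ℕ)
    (μ₁ : Hist A₁ A₂ → A₁) (μ₂ : Hist A₁ A₂ → A₂) : Prop :=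
  ∀ h : Hist A₁ A₂, h.length < T → isNEpp u₁ u₂ (T - h.length) (condS μ₁ h) (condS μ₂ h)

/-- `G ∈ 𝒢_LS^{p,p}`: local suboptimality occurs in some SPE of some `G(T)`,
both players restricted to pure strategies. -/
def GLSpp (u₁ u₂ : A₁ → A₂ → ℝ) : Prop :=
  ∃ T : ℕ, 1 ≤ T ∧ ∃ (μ₁ : Hist A₁ A₂ → A₁) (μ₂ : Hist A₁ A₂ → A₂),
    isSPEpp u₁ u₂ T μ₁ μ₂ ∧ ∃ h : Hist A₁ A₂, h.length < T ∧ (μ₁ h, μ₂ h) ∉ NashPP u₁ u₂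

/-- `G ∈ 𝒢_LS^{m,p}`: local suboptimality occurs in some SPE of some `G(T)`,
player 1 mixed and player 2 pure. -/
def GLSmp (u₁ u₂ : A₁ → A₂ → ℝ) : Prop :=
  ∃ T : ℕ, 1 ≤ T ∧ ∃ (μ₁ : Hist A₁ A₂ → Mix A₁) (μ₂ : Hist A₁ A₂ → A₂),
    isSPEmp u₁ u₂ T μ₁ μ₂ ∧ ∃ h : Hist A₁ A₂, h.length < T ∧ (μ₁ h, μ₂ h) ∉ NashMP u₁ u₂

/-- `G ∈ 𝒢_LS^{m,m}`: local suboptimality occurs in some SPE of some `G(T)`,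
both players mixed. -/
def GLSmm (u₁ u₂ : A₁ → A₂ → ℝ) : Prop :=
  ∃ T : ℕ, 1 ≤ T ∧ ∃ (μ₁ : Hist A₁ A₂ → Mix A₁) (μ₂ : Hist A₁ A₂ → Mix A₂),
    isSPEmm u₁ u₂ T μ₁ μ₂ ∧ ∃ h : Hist A₁ A₂, h.length < T ∧ (μ₁ h, μ₂ h) ∉ NashMM u₁ u₂

/-- The pure-pure characterization condition (condition of the pure-strategy theorem). -/
def condPP (u₁ u₂ : A₁ → A₂ → ℝ) : Prop :=
  ((V1pp u₁ u₂).Nontrivial ∧ (V2pp u₁ u₂).Nontrivial ∧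
    ∃ (a₁ : A₁) (a₂ : A₂), (a₁, a₂) ∉ NashPP u₁ u₂) ∨
  ((V1pp u₁ u₂).Nontrivial ∧ oneVal (V2pp u₁ u₂) ∧
    ∃ (a₁ a₁' : A₁) (a₂ : A₂), u₁ a₁ a₂ < u₁ a₁' a₂ ∧ BR2p u₂ a₁ a₂) ∨
  (oneVal (V1pp u₁ u₂) ∧ (V2pp u₁ u₂).Nontrivial ∧
    ∃ (a₁ : A₁) (a₂ a₂' : A₂), u₂ a₁ a₂ < u₂ a₁ a₂' ∧ BR1p u₁ a₁ a₂)

/-- The mixed-mixed characterization condition (condition of the general-case theorem). -/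
def condMM (u₁ u₂ : A₁ → A₂ → ℝ) : Prop :=
  ((V1mm u₁ u₂).Nontrivial ∧ (V2mm u₁ u₂).Nontrivial ∧
    ∃ (σ₁ : Mix A₁) (σ₂ : Mix A₂), (σ₁, σ₂) ∉ NashMM u₁ u₂) ∨
  ((V1mm u₁ u₂).Nontrivial ∧ oneVal (V2mm u₁ u₂) ∧
    ∃ (σ₁ : Mix A₁) (σ₂ : Mix A₂) (a₁' : A₁),
      expPay u₁ σ₁ σ₂ < expPay u₁ (Mix.pure a₁') σ₂ ∧ BR2m u₂ σ₁ σ₂) ∨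
  (oneVal (V1mm u₁ u₂) ∧ (V2mm u₁ u₂).Nontrivial ∧
    ∃ (σ₁ : Mix A₁) (σ₂ : Mix A₂) (a₂' : A₂),
      expPay u₂ σ₁ σ₂ < expPay u₂ σ₁ (Mix.pure a₂') ∧ BR1m u₁ σ₁ σ₂)

/-- The set `D` of differences of player 1's payoffs between pairs of stage-game
Nash equilibria (mixed-pure case). -/
def Dmp (u₁ u₂ : A₁ → A₂ → ℝ) : Set ℝ :=
  {x | ∃ q ∈ NashMP u₁ u₂, ∃ q' ∈ NashMP u₁ u₂,
    x = expPay u₁ q.1 (Mix.pure q.2) - expPay u₁ q'.1 (Mix.pure q'.2)}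

/-- `x` is a finite (possibly empty) sum of elements of `D`. -/
def sumOfD (D : Set ℝ) (x : ℝ) : Prop :=
  ∃ (n : ℕ) (d : Fin n → ℝ), (∀ k, d k ∈ D) ∧ x = ∑ k, d k

/-- The mixed-pure characterization condition (condition of the
pure-strategy-against-mixed-strategy theorem). -/
def condMP (u₁ u₂ : A₁ → A₂ → ℝ) : Prop :=
  ((V1mp u₁ u₂).Nontrivial ∧ (V2mp u₁ u₂).Nontrivial ∧
    ∃ (σ₁ : Mix A₁) (a₂ : A₂), (σ₁, a₂) ∉ NashMP u₁ u₂) ∨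
  ((V1mp u₁ u₂).Nontrivial ∧ oneVal (V2mp u₁ u₂) ∧
    ∃ (σ₁ : Mix A₁) (a₁' : A₁) (a₂ : A₂),
      expPay u₁ σ₁ (Mix.pure a₂) < u₁ a₁' a₂ ∧
      BR2pm u₂ σ₁ a₂ ∧
      (σ₁.support.Nontrivial →
        ∃ a ∈ σ₁.support, ∀ a' ∈ σ₁.support, a' ≠ a →
          sumOfD (Dmp u₁ u₂) (u₁ a a₂ - u₁ a' a₂))) ∨
  (oneVal (V1mp u₁ u₂) ∧ (V2mp u₁ u₂).Nontrivial ∧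
    ∃ (σ₁ : Mix A₁) (a₂ a₂' : A₂),
      expPay u₂ σ₁ (Mix.pure a₂) < expPay u₂ σ₁ (Mix.pure a₂') ∧
      BR1m u₁ σ₁ (Mix.pure a₂))

/-- A history is reachable under the behavior profile `(μ₁, μ₂)` (mixed-pure case):
every action of player 1 along it has positive probability and every action of
player 2 along it is the prescribed one. -/
def reachableMP (μ₁ : Hist A₁ A₂ → Mix A₁) (μ₂ : Hist A₁ A₂ → A₂) (h : Hist A₁ A₂) : Prop :=
  ∀ k : Fin h.length, 0 < (μ₁ (h.take k.val)).p (h.get k).1 ∧ μ₂ (h.take k.val) = (h.get k).2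

end TwoPlayer

section ExpectedPayoff

variable {A₁ A₂ : Type*} [Fintype A₁] [Fintype A₂]

lemma expPay_eq_sum_left (u : A₁ → A₂ → ℝ) (σ : Mix A₁) (τ : Mix A₂) :
    expPay u σ τ = ∑ a, σ.p a * ∑ b, τ.p b * u a b := by
  simp only [expPay, Finset.mul_sum, mul_assoc]

lemma expPay_flip (u : A₁ → A₂ → ℝ) (σ : Mix A₁) (τ : Mix A₂) :
    expPay (fun b a => u a b) τ σ = expPay u σ τ := by
  unfold expPay
  rw [Finset.sum_comm]
  simp only [mul_comm (σ.p _)]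

lemma expPay_eq_sum_right (u : A₁ → A₂ → ℝ) (σ : Mix A₁) (τ : Mix A₂) :
    expPay u σ τ = ∑ b, τ.p b * ∑ a, σ.p a * u a b := by
  rw [← expPay_flip, expPay_eq_sum_left]

lemma Mix.sum_pure_mul {A : Type*} [Fintype A] [DecidableEq A] (a : A) (f : A → ℝ) :
    ∑ b, (Mix.pure a).p b * f b = f a := by
  simp [Mix.pure]

lemma Mix.sum_mul_le {A : Type*} [Fintype A] (σ : Mix A) {f : A → ℝ} {c : ℝ}
    (h : ∀ a, f a ≤ c) : ∑ a, σ.p a * f a ≤ c := by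
  calc ∑ a, σ.p a * f a ≤ ∑ a, σ.p a * c :=
        Finset.sum_le_sum fun a _ => mul_le_mul_of_nonneg_left (h a) (σ.nonneg a)
    _ = c := by rw [← Finset.sum_mul, σ.sum_one, one_mul]

lemma expPay_pure_left [DecidableEq A₁] (u : A₁ → A₂ → ℝ) (a : A₁) (τ : Mix A₂) :
    expPay u (Mix.pure a) τ = ∑ b, τ.p b * u a b := by
  rw [expPay_eq_sum_left, Mix.sum_pure_mul]

lemma expPay_pure_right [DecidableEq A₂] (u : A₁ → A₂ → ℝ) (σ : Mix A₁) (b : A₂) :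
    expPay u σ (Mix.pure b) = ∑ a, σ.p a * u a b := by
  rw [expPay_eq_sum_right, Mix.sum_pure_mul]

lemma expPay_pure_pure [DecidableEq A₁] [DecidableEq A₂] (u : A₁ → A₂ → ℝ) (a : A₁) (b : A₂) :
    expPay u (Mix.pure a) (Mix.pure b) = u a b := by
  rw [expPay_pure_left, Mix.sum_pure_mul]

lemma expPay_add_const (u : A₁ → A₂ → ℝ) (c : ℝ) (σ : Mix A₁) (τ : Mix A₂) :
    expPay (fun a b => u a b + c) σ τ = expPay u σ τ + c := by
  simp only [expPay_eq_sum_left, mul_add, Finset.sum_add_distrib, ← Finset.sum_mul, τ.sum_one,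
    σ.sum_one, one_mul]

lemma expPay_mono {u v : A₁ → A₂ → ℝ} (h : ∀ a b, u a b ≤ v a b) (σ : Mix A₁) (τ : Mix A₂) :
    expPay u σ τ ≤ expPay v σ τ :=
  Finset.sum_le_sum fun a _ => Finset.sum_le_sum fun b _ =>
    mul_le_mul_of_nonneg_left (h a b) (mul_nonneg (σ.nonneg a) (τ.nonneg b))

lemma BR1m_iff_pure [DecidableEq A₁] {u : A₁ → A₂ → ℝ} {σ : Mix A₁} {τ : Mix A₂} :
    BR1m u σ τ ↔ ∀ a, expPay u (Mix.pure a) τ ≤ expPay u σ τ := by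
  refine ⟨fun h a => h _, fun h ρ => ?_⟩
  rw [expPay_eq_sum_left u ρ]
  exact ρ.sum_mul_le fun a => by rw [← expPay_pure_left]; exact h a

lemma BR2m_iff_pure [DecidableEq A₂] {u : A₁ → A₂ → ℝ} {σ : Mix A₁} {τ : Mix A₂} :
    BR2m u σ τ ↔ ∀ b, expPay u σ (Mix.pure b) ≤ expPay u σ τ := by
  refine ⟨fun h a => h _, fun h ρ => ?_⟩
  rw [expPay_eq_sum_right u _ ρ]
  exact ρ.sum_mul_le fun a => by rw [← expPay_pure_right]; exact h a

/-- If every pure profile is a Nash equilibrium, then so is every mixed profile. -/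
lemma mem_NashMM_of_forall_mem_NashPP [DecidableEq A₁] [DecidableEq A₂] {u₁ u₂ : A₁ → A₂ → ℝ}
    (h : ∀ a b, (a, b) ∈ NashPP u₁ u₂) (σ : Mix A₁) (τ : Mix A₂) :
    (σ, τ) ∈ NashMM u₁ u₂ := by
  constructor
  · rw [BR1m_iff_pure]
    intro a
    rw [expPay_pure_left, expPay_eq_sum_right]
    refine Finset.sum_le_sum fun b _ => mul_le_mul_of_nonneg_left ?_ (τ.nonneg b)
    have := σ.sum_mul_le (f := fun a' => - u₁ a' b) (c := - u₁ a b)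
      fun a' => neg_le_neg ((h a' b).1 a)
    simp only [mul_neg, Finset.sum_neg_distrib] at this
    linarith
  · rw [BR2m_iff_pure]
    intro b
    rw [expPay_pure_right, expPay_eq_sum_left]
    refine Finset.sum_le_sum fun a _ => mul_le_mul_of_nonneg_left ?_ (σ.nonneg a)
    have := τ.sum_mul_le (f := fun b' => - u₂ a b') (c := - u₂ a b)
      fun b' => neg_le_neg ((h a b').2 b)
    simp only [mul_neg, Finset.sum_neg_distrib] at this
    linarith

end ExpectedPayoff

section StrategyClass

variable {A₁ A₂ S₁ S₂ : Type*} [Fintype A₁] [Fintype A₂]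

/-- Player 1's best responses within the class of strategies parametrized by `e₁`. -/
def ClassBR1 (e₁ : S₁ → Mix A₁) (e₂ : S₂ → Mix A₂) (u : A₁ → A₂ → ℝ) (s : S₁) (t : S₂) : Prop :=
  ∀ s', expPay u (e₁ s') (e₂ t) ≤ expPay u (e₁ s) (e₂ t)

/-- Player 2's best responses within the class of strategies parametrized by `e₂`. -/
def ClassBR2 (e₁ : S₁ → Mix A₁) (e₂ : S₂ → Mix A₂) (u : A₁ → A₂ → ℝ) (s : S₁) (t : S₂) : Prop :=
  ∀ t', expPay u (e₁ s) (e₂ t') ≤ expPay u (e₁ s) (e₂ t)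

/-- Nash equilibria in the strategy classes parametrized by `e₁` and `e₂`. -/
def ClassNash (e₁ : S₁ → Mix A₁) (e₂ : S₂ → Mix A₂) (u₁ u₂ : A₁ → A₂ → ℝ) (s : S₁) (t : S₂) :
    Prop :=
  ClassBR1 e₁ e₂ u₁ s t ∧ ClassBR2 e₁ e₂ u₂ s t

/-- Subgame-perfect equilibria of the `T`-round game in the strategy classes parametrized by
`e₁` and `e₂`. -/
def ClassSPE (e₁ : S₁ → Mix A₁) (e₂ : S₂ → Mix A₂) (u₁ u₂ : A₁ → A₂ → ℝ) (T : ℕ)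
    (μ₁ : Hist A₁ A₂ → S₁) (μ₂ : Hist A₁ A₂ → S₂) : Prop :=
  ∀ h : Hist A₁ A₂, h.length < T →
    (∀ ν₁ : Hist A₁ A₂ → S₁,
      totPay u₁ (fun k => e₁ (ν₁ k)) (fun k => e₂ (condS μ₂ h k)) (T - h.length) [] ≤
      totPay u₁ (fun k => e₁ (condS μ₁ h k)) (fun k => e₂ (condS μ₂ h k)) (T - h.length) []) ∧
    (∀ ν₂ : Hist A₁ A₂ → S₂,
      totPay u₂ (fun k => e₁ (condS μ₁ h k)) (fun k => e₂ (ν₂ k)) (T - h.length) [] ≤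
      totPay u₂ (fun k => e₁ (condS μ₁ h k)) (fun k => e₂ (condS μ₂ h k)) (T - h.length) [])

/-- Occurrence of local suboptimality in the strategy classes parametrized by `e₁` and `e₂`. -/
def ClassLS (e₁ : S₁ → Mix A₁) (e₂ : S₂ → Mix A₂) (u₁ u₂ : A₁ → A₂ → ℝ) : Prop :=
  ∃ T : ℕ, 1 ≤ T ∧ ∃ (μ₁ : Hist A₁ A₂ → S₁) (μ₂ : Hist A₁ A₂ → S₂),
    ClassSPE e₁ e₂ u₁ u₂ T μ₁ μ₂ ∧
      ∃ h : Hist A₁ A₂, h.length < T ∧ ¬ ClassNash e₁ e₂ u₁ u₂ (μ₁ h) (μ₂ h)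

/-- The stage payoff augmented by the continuation payoff of the `n` subsequent rounds. -/
def augPay (u : A₁ → A₂ → ℝ) (μ₁ : Hist A₁ A₂ → Mix A₁) (μ₂ : Hist A₁ A₂ → Mix A₂) (n : ℕ)
    (h : Hist A₁ A₂) (a : A₁) (b : A₂) : ℝ :=
  u a b + totPay u μ₁ μ₂ n (h ++ [(a, b)])

lemma totPay_succ (u : A₁ → A₂ → ℝ) (μ₁ : Hist A₁ A₂ → Mix A₁) (μ₂ : Hist A₁ A₂ → Mix A₂)
    (n : ℕ) (h : Hist A₁ A₂) :
    totPay u μ₁ μ₂ (n + 1) h = expPay (augPay u μ₁ μ₂ n h) (μ₁ h) (μ₂ h) := rfl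

lemma totPay_congr (u : A₁ → A₂ → ℝ) {μ₁ ν₁ : Hist A₁ A₂ → Mix A₁} {μ₂ ν₂ : Hist A₁ A₂ → Mix A₂}
    (n : ℕ) {h g : Hist A₁ A₂} (h₁ : ∀ k, μ₁ (h ++ k) = ν₁ (g ++ k))
    (h₂ : ∀ k, μ₂ (h ++ k) = ν₂ (g ++ k)) :
    totPay u μ₁ μ₂ n h = totPay u ν₁ ν₂ n g := by
  induction n generalizing h g with
  | zero => rfl
  | succ n ih =>
    have e₁ := h₁ []
    have e₂ := h₂ []
    simp only [List.append_nil] at e₁ e₂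
    rw [totPay_succ, totPay_succ, e₁, e₂]
    congr 1
    funext a b
    unfold augPay
    rw [ih (g := g ++ [(a, b)])] <;> intro k <;> simp [h₁, h₂]

lemma totPay_condS (u : A₁ → A₂ → ℝ) (e₁ : S₁ → Mix A₁) (e₂ : S₂ → Mix A₂)
    (μ₁ : Hist A₁ A₂ → S₁) (μ₂ : Hist A₁ A₂ → S₂) (n : ℕ) (h : Hist A₁ A₂) :
    totPay u (fun k => e₁ (condS μ₁ h k)) (fun k => e₂ (condS μ₂ h k)) n [] =
      totPay u (fun k => e₁ (μ₁ k)) (fun k => e₂ (μ₂ k)) n h :=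
  totPay_congr u n (fun k => by simp [condS]) (fun k => by simp [condS])

/-- The one-shot deviation principle. -/
lemma ClassSPE_iff (e₁ : S₁ → Mix A₁) (e₂ : S₂ → Mix A₂) (u₁ u₂ : A₁ → A₂ → ℝ) (T : ℕ)
    (μ₁ : Hist A₁ A₂ → S₁) (μ₂ : Hist A₁ A₂ → S₂) :
    ClassSPE e₁ e₂ u₁ u₂ T μ₁ μ₂ ↔
      ∀ (h : Hist A₁ A₂) (n : ℕ), h.length + (n + 1) = T →
        ClassNash e₁ e₂ (augPay u₁ (fun k => e₁ (μ₁ k)) (fun k => e₂ (μ₂ k)) n h)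
          (augPay u₂ (fun k => e₁ (μ₁ k)) (fun k => e₂ (μ₂ k)) n h) (μ₁ h) (μ₂ h) := by
  constructor
  · intro H h n hn
    obtain ⟨H₁, H₂⟩ := H h (by omega)
    have hT : T - h.length = n + 1 := by omega
    rw [hT] at H₁ H₂
    constructor
    · intro s
      have := H₁ fun k => if k = [] then s else condS μ₁ h k
      rw [totPay_condS] at this
      rw [totPay_succ, totPay_succ] at this
      refine le_trans (le_of_eq ?_) this
      simp only [if_true]
      congr 1
      · funext a b
        unfold augPay
        congr 1
        exact totPay_congr u₁ n (fun k => by simp [condS]) (fun k => by simp [condS])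
      · simp [condS]
    · intro s
      have := H₂ fun k => if k = [] then s else condS μ₂ h k
      rw [totPay_condS] at this
      rw [totPay_succ, totPay_succ] at this
      refine le_trans (le_of_eq ?_) this
      simp only [if_true]
      congr 1
      · funext a b
        unfold augPay
        congr 1
        exact totPay_congr u₂ n (fun k => by simp [condS]) (fun k => by simp [condS])
      · simp [condS]
  · intro H h hh
    have key₁ : ∀ (ν₁ : Hist A₁ A₂ → S₁) (n : ℕ) (g : Hist A₁ A₂), (h ++ g).length + n = T →
        totPay u₁ (fun k => e₁ (ν₁ k)) (fun k => e₂ (condS μ₂ h k)) n g ≤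
          totPay u₁ (fun k => e₁ (μ₁ k)) (fun k => e₂ (μ₂ k)) n (h ++ g) := by
      intro ν₁ n
      induction n with
      | zero => intro g _; exact le_rfl
      | succ n ih =>
        intro g hg
        refine le_trans ?_ ((H (h ++ g) n hg).1 (ν₁ g))
        rw [totPay_succ]
        refine expPay_mono (fun a b => ?_) _ _
        have := ih (g ++ [(a, b)]) (by simp at hg ⊢; omega)
        rw [← List.append_assoc] at this
        unfold augPay
        linarith
    have key₂ : ∀ (ν₂ : Hist A₁ A₂ → S₂) (n : ℕ) (g : Hist A₁ A₂), (h ++ g).length + n = T →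
        totPay u₂ (fun k => e₁ (condS μ₁ h k)) (fun k => e₂ (ν₂ k)) n g ≤
          totPay u₂ (fun k => e₁ (μ₁ k)) (fun k => e₂ (μ₂ k)) n (h ++ g) := by
      intro ν₂ n
      induction n with
      | zero => intro g _; exact le_rfl
      | succ n ih =>
        intro g hg
        refine le_trans ?_ ((H (h ++ g) n hg).2 (ν₂ g))
        rw [totPay_succ]
        refine expPay_mono (fun a b => ?_) _ _
        have := ih (g ++ [(a, b)]) (by simp at hg ⊢; omega)
        rw [← List.append_assoc] at this
        unfold augPay
        linarith
    rw [totPay_condS, totPay_condS]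
    constructor <;> intro ν
    · simpa using key₁ ν (T - h.length) [] (by simp; omega)
    · simpa using key₂ ν (T - h.length) [] (by simp; omega)

lemma ClassBR1.of_add_const {e₁ : S₁ → Mix A₁} {e₂ : S₂ → Mix A₂} {u v : A₁ → A₂ → ℝ} {c : ℝ}
    {s : S₁} {t : S₂} (H : ClassBR1 e₁ e₂ v s t) (hv : ∀ a b, v a b = u a b + c) :
    ClassBR1 e₁ e₂ u s t := by
  obtain rfl : v = fun a b => u a b + c := by funext a b; exact hv a b
  intro s'
  simpa [expPay_add_const] using H s'

lemma ClassBR2.of_add_const {e₁ : S₁ → Mix A₁} {e₂ : S₂ → Mix A₂} {u v : A₁ → A₂ → ℝ} {c : ℝ}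
    {s : S₁} {t : S₂} (H : ClassBR2 e₁ e₂ v s t) (hv : ∀ a b, v a b = u a b + c) :
    ClassBR2 e₁ e₂ u s t := by
  obtain rfl : v = fun a b => u a b + c := by funext a b; exact hv a b
  intro s'
  simpa [expPay_add_const] using H s'

lemma totPay_succ_of_forall_eq {u : A₁ → A₂ → ℝ} {μ₁ : Hist A₁ A₂ → Mix A₁}
    {μ₂ : Hist A₁ A₂ → Mix A₂} {n : ℕ} {h : Hist A₁ A₂} {c : ℝ}
    (H : ∀ a b, totPay u μ₁ μ₂ n (h ++ [(a, b)]) = c) :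
    totPay u μ₁ μ₂ (n + 1) h = expPay u (μ₁ h) (μ₂ h) + c := by
  rw [totPay_succ, ← expPay_add_const]
  unfold augPay
  simp only [H]

lemma ClassLS.exists_not_nash {e₁ : S₁ → Mix A₁} {e₂ : S₂ → Mix A₂} {u₁ u₂ : A₁ → A₂ → ℝ}
    (H : ClassLS e₁ e₂ u₁ u₂) : ∃ s t, ¬ ClassNash e₁ e₂ u₁ u₂ s t := by
  obtain ⟨T, -, μ₁, μ₂, -, h, -, hN⟩ := H
  exact ⟨_, _, hN⟩

lemma ClassLS.exists_nash [Nonempty A₁] [Nonempty A₂] {e₁ : S₁ → Mix A₁} {e₂ : S₂ → Mix A₂}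
    {u₁ u₂ : A₁ → A₂ → ℝ} (H : ClassLS e₁ e₂ u₁ u₂) : ∃ s t, ClassNash e₁ e₂ u₁ u₂ s t := by
  obtain ⟨T, hT, μ₁, μ₂, hS, -⟩ := H
  rw [ClassSPE_iff] at hS
  let h : Hist A₁ A₂ := List.replicate (T - 1) (Classical.arbitrary _, Classical.arbitrary _)
  obtain ⟨h₁, h₂⟩ := hS h 0 (by simp [h]; omega)
  exact ⟨μ₁ h, μ₂ h, h₁.of_add_const (c := 0) fun a b => rfl,
    h₂.of_add_const (c := 0) fun a b => rfl⟩

/-- If each player gets the same payoff in all stage-game equilibria, there is no local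
suboptimality. -/
lemma not_ClassLS_of_const {e₁ : S₁ → Mix A₁} {e₂ : S₂ → Mix A₂} {u₁ u₂ : A₁ → A₂ → ℝ} {v₁ v₂ : ℝ}
    (h₁ : ∀ s t, ClassNash e₁ e₂ u₁ u₂ s t → expPay u₁ (e₁ s) (e₂ t) = v₁)
    (h₂ : ∀ s t, ClassNash e₁ e₂ u₁ u₂ s t → expPay u₂ (e₁ s) (e₂ t) = v₂) :
    ¬ ClassLS e₁ e₂ u₁ u₂ := by
  rintro ⟨T, -, μ₁, μ₂, hS, h, hh, hN⟩
  rw [ClassSPE_iff] at hS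
  have nash : ∀ n (g : Hist A₁ A₂), g.length + (n + 1) = T →
      (∀ a b, totPay u₁ (fun k => e₁ (μ₁ k)) (fun k => e₂ (μ₂ k)) n (g ++ [(a, b)]) = n * v₁) →
      (∀ a b, totPay u₂ (fun k => e₁ (μ₁ k)) (fun k => e₂ (μ₂ k)) n (g ++ [(a, b)]) = n * v₂) →
      ClassNash e₁ e₂ u₁ u₂ (μ₁ g) (μ₂ g) := fun n g hg p₁ p₂ =>
    ⟨(hS g n hg).1.of_add_const fun a b => by rw [augPay, p₁],
      (hS g n hg).2.of_add_const fun a b => by rw [augPay, p₂]⟩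
  have key : ∀ n (g : Hist A₁ A₂), g.length + n = T →
      totPay u₁ (fun k => e₁ (μ₁ k)) (fun k => e₂ (μ₂ k)) n g = n * v₁ ∧
      totPay u₂ (fun k => e₁ (μ₁ k)) (fun k => e₂ (μ₂ k)) n g = n * v₂ := by
    intro n
    induction n with
    | zero => intro g _; simp [totPay]
    | succ n ih =>
      intro g hg
      have p := fun a b => ih (g ++ [(a, b)]) (by simp; omega)
      have hN := nash n g hg (fun a b => (p a b).1) (fun a b => (p a b).2)
      rw [totPay_succ_of_forall_eq fun a b => (p a b).1,
        totPay_succ_of_forall_eq fun a b => (p a b).2, h₁ _ _ hN, h₂ _ _ hN]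
      push_cast
      constructor <;> ring
  have p := fun a b => key (T - h.length - 1) (h ++ [(a, b)]) (by simp; omega)
  exact hN (nash (T - h.length - 1) h (by omega) (fun a b => (p a b).1) (fun a b => (p a b).2))

lemma not_ClassLS_of_BR2_imp {e₁ : S₁ → Mix A₁} {e₂ : S₂ → Mix A₂} {u₁ u₂ : A₁ → A₂ → ℝ} {v : ℝ}
    (hv : ∀ s t, ClassNash e₁ e₂ u₁ u₂ s t → expPay u₂ (e₁ s) (e₂ t) = v)
    (himp : ∀ s t, ClassBR2 e₁ e₂ u₂ s t → ClassBR1 e₁ e₂ u₁ s t) :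
    ¬ ClassLS e₁ e₂ u₁ u₂ := by
  rintro ⟨T, -, μ₁, μ₂, hS, h, hh, hN⟩
  rw [ClassSPE_iff] at hS
  have nash : ∀ n (g : Hist A₁ A₂), g.length + (n + 1) = T →
      (∀ a b, totPay u₂ (fun k => e₁ (μ₁ k)) (fun k => e₂ (μ₂ k)) n (g ++ [(a, b)]) = n * v) →
      ClassNash e₁ e₂ u₁ u₂ (μ₁ g) (μ₂ g) := fun n g hg p =>
    have br := (hS g n hg).2.of_add_const fun a b => by rw [augPay, p]
    ⟨himp _ _ br, br⟩
  have key : ∀ n (g : Hist A₁ A₂), g.length + n = T →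
      totPay u₂ (fun k => e₁ (μ₁ k)) (fun k => e₂ (μ₂ k)) n g = n * v := by
    intro n
    induction n with
    | zero => intro g _; simp [totPay]
    | succ n ih =>
      intro g hg
      have p := fun a b => ih (g ++ [(a, b)]) (by simp; omega)
      rw [totPay_succ_of_forall_eq p, hv _ _ (nash n g hg p)]
      push_cast
      ring
  exact hN (nash (T - h.length - 1) h (by omega) fun a b => key _ _ (by simp; omega))

lemma not_ClassLS_of_BR1_imp {e₁ : S₁ → Mix A₁} {e₂ : S₂ → Mix A₂} {u₁ u₂ : A₁ → A₂ → ℝ} {v : ℝ}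
    (hv : ∀ s t, ClassNash e₁ e₂ u₁ u₂ s t → expPay u₁ (e₁ s) (e₂ t) = v)
    (himp : ∀ s t, ClassBR1 e₁ e₂ u₁ s t → ClassBR2 e₁ e₂ u₂ s t) :
    ¬ ClassLS e₁ e₂ u₁ u₂ := by
  rintro ⟨T, -, μ₁, μ₂, hS, h, hh, hN⟩
  rw [ClassSPE_iff] at hS
  have nash : ∀ n (g : Hist A₁ A₂), g.length + (n + 1) = T →
      (∀ a b, totPay u₁ (fun k => e₁ (μ₁ k)) (fun k => e₂ (μ₂ k)) n (g ++ [(a, b)]) = n * v) →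
      ClassNash e₁ e₂ u₁ u₂ (μ₁ g) (μ₂ g) := fun n g hg p =>
    have br := (hS g n hg).1.of_add_const fun a b => by rw [augPay, p]
    ⟨br, himp _ _ br⟩
  have key : ∀ n (g : Hist A₁ A₂), g.length + n = T →
      totPay u₁ (fun k => e₁ (μ₁ k)) (fun k => e₂ (μ₂ k)) n g = n * v := by
    intro n
    induction n with
    | zero => intro g _; simp [totPay]
    | succ n ih =>
      intro g hg
      have p := fun a b => ih (g ++ [(a, b)]) (by simp; omega)
      rw [totPay_succ_of_forall_eq p, hv _ _ (nash n g hg p)]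
      push_cast
      ring
  exact hN (nash (T - h.length - 1) h (by omega) fun a b => key _ _ (by simp; omega))

/-- A stage profile that is an equilibrium once continuation payoffs along stage-equilibrium
paths are added, but not before, yields local suboptimality. -/
lemma ClassLS_of_continuation {e₁ : S₁ → Mix A₁} {e₂ : S₂ → Mix A₂} {u₁ u₂ : A₁ → A₂ → ℝ}
    (L : ℕ) (c : A₁ → A₂ → ℕ → S₁ × S₂)
    (hc : ∀ a b k, ClassNash e₁ e₂ u₁ u₂ (c a b k).1 (c a b k).2) {s : S₁} {t : S₂}
    (hs : ClassNash e₁ e₂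
      (fun a b => u₁ a b + ∑ k ∈ range L, expPay u₁ (e₁ (c a b k).1) (e₂ (c a b k).2))
      (fun a b => u₂ a b + ∑ k ∈ range L, expPay u₂ (e₁ (c a b k).1) (e₂ (c a b k).2)) s t)
    (hN : ¬ ClassNash e₁ e₂ u₁ u₂ s t) : ClassLS e₁ e₂ u₁ u₂ := by
  let μ₁ : Hist A₁ A₂ → S₁
    | [] => s
    | x :: h => (c x.1 x.2 h.length).1
  let μ₂ : Hist A₁ A₂ → S₂
    | [] => t
    | x :: h => (c x.1 x.2 h.length).2
  have pay : ∀ (u : A₁ → A₂ → ℝ) (x : A₁ × A₂) (n : ℕ) (h : Hist A₁ A₂),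
      totPay u (fun k => e₁ (μ₁ k)) (fun k => e₂ (μ₂ k)) n (x :: h) =
        ∑ k ∈ range n, expPay u (e₁ (c x.1 x.2 (h.length + k)).1)
          (e₂ (c x.1 x.2 (h.length + k)).2) := by
    intro u x n
    induction n with
    | zero => intro h; simp [totPay]
    | succ n ih =>
      intro h
      have tail : ∀ a b,
          totPay u (fun k => e₁ (μ₁ k)) (fun k => e₂ (μ₂ k)) n ((x :: h) ++ [(a, b)]) =
          ∑ k ∈ range n, expPay u (e₁ (c x.1 x.2 (h.length + (k + 1))).1)
            (e₂ (c x.1 x.2 (h.length + (k + 1))).2) := by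
        intro a b
        rw [List.cons_append, ih]
        simp [add_assoc, add_comm 1]
      rw [totPay_succ_of_forall_eq tail, Finset.sum_range_succ', add_comm]
      simp [μ₁, μ₂]
  refine ⟨L + 1, by omega, μ₁, μ₂, ?_, [], by simp, hN⟩
  rw [ClassSPE_iff]
  rintro (_ | ⟨x, h⟩) n hn
  · obtain rfl : n = L := by simpa using hn
    convert hs using 3 <;> simp [augPay, pay]
  · have aug : ∀ u : A₁ → A₂ → ℝ, ∃ C, augPay u (fun k => e₁ (μ₁ k)) (fun k => e₂ (μ₂ k)) n (x :: h)
        = fun a b => u a b + C := by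
      intro u
      refine ⟨∑ k ∈ range n, expPay u (e₁ (c x.1 x.2 (h.length + 1 + k)).1)
          (e₂ (c x.1 x.2 (h.length + 1 + k)).2), ?_⟩
      funext a b
      rw [augPay, List.cons_append, pay]
      simp
    obtain ⟨C₁, hC₁⟩ := aug u₁
    obtain ⟨C₂, hC₂⟩ := aug u₂
    rw [hC₁, hC₂]
    obtain ⟨n₁, n₂⟩ := hc x.1 x.2 h.length
    exact ⟨n₁.of_add_const (c := -C₁) fun a b => by ring,
      n₂.of_add_const (c := -C₂) fun a b => by ring⟩

lemma sum_range_ite_lt {k L : ℕ} (hk : k ≤ L) (x y : ℝ) :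
    ∑ i ∈ range L, (if i < k then x else y) = k * (x - y) + L * y := by
  obtain ⟨m, rfl⟩ := Nat.exists_eq_add_of_le hk
  rw [Finset.sum_range_add, Finset.sum_congr rfl fun i hi => if_pos (Finset.mem_range.1 hi)]
  simp
  ring

/-- Rewarding the pure outcome `(a, b)` by `K₁ a b` switches from the equilibrium `p'` to `p` and
`K₂ a b` switches from `q'` to `q`. -/
lemma ClassLS_of_rewards {e₁ : S₁ → Mix A₁} {e₂ : S₂ → Mix A₂} {u₁ u₂ : A₁ → A₂ → ℝ}
    {p p' q q' : S₁ × S₂} (hp : ClassNash e₁ e₂ u₁ u₂ p.1 p.2)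
    (hp' : ClassNash e₁ e₂ u₁ u₂ p'.1 p'.2) (hq : ClassNash e₁ e₂ u₁ u₂ q.1 q.2)
    (hq' : ClassNash e₁ e₂ u₁ u₂ q'.1 q'.2) (K₁ K₂ : A₁ → A₂ → ℕ) {s : S₁} {t : S₂}
    (hs : ClassBR1 e₁ e₂ (fun a b => u₁ a b +
      (K₁ a b * (expPay u₁ (e₁ p.1) (e₂ p.2) - expPay u₁ (e₁ p'.1) (e₂ p'.2)) +
       K₂ a b * (expPay u₁ (e₁ q.1) (e₂ q.2) - expPay u₁ (e₁ q'.1) (e₂ q'.2)))) s t)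
    (ht : ClassBR2 e₁ e₂ (fun a b => u₂ a b +
      (K₁ a b * (expPay u₂ (e₁ p.1) (e₂ p.2) - expPay u₂ (e₁ p'.1) (e₂ p'.2)) +
       K₂ a b * (expPay u₂ (e₁ q.1) (e₂ q.2) - expPay u₂ (e₁ q'.1) (e₂ q'.2)))) s t)
    (hN : ¬ ClassNash e₁ e₂ u₁ u₂ s t) : ClassLS e₁ e₂ u₁ u₂ := by
  obtain ⟨L, hL⟩ : ∃ L, ∀ a b, K₁ a b ≤ L ∧ K₂ a b ≤ L := by
    refine ⟨∑ x : A₁ × A₂, (K₁ x.1 x.2 + K₂ x.1 x.2), fun a b => ?_⟩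
    have := Finset.single_le_sum (f := fun x : A₁ × A₂ => K₁ x.1 x.2 + K₂ x.1 x.2)
      (fun _ _ => Nat.zero_le _) (Finset.mem_univ (a, b))
    simp only at this
    omega
  let c : A₁ → A₂ → ℕ → S₁ × S₂ := fun a b k =>
    if k < L then (if k < K₁ a b then p else p') else (if k - L < K₂ a b then q else q')
  have pay : ∀ (u : A₁ → A₂ → ℝ) a b,
      ∑ k ∈ range (L + L), expPay u (e₁ (c a b k).1) (e₂ (c a b k).2) =
      (K₁ a b * (expPay u (e₁ p.1) (e₂ p.2) - expPay u (e₁ p'.1) (e₂ p'.2)) +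
        K₂ a b * (expPay u (e₁ q.1) (e₂ q.2) - expPay u (e₁ q'.1) (e₂ q'.2))) +
      (L * expPay u (e₁ p'.1) (e₂ p'.2) + L * expPay u (e₁ q'.1) (e₂ q'.2)) := by
    intro u a b
    rw [Finset.sum_range_add]
    have E₁ : ∀ k ∈ range L, expPay u (e₁ (c a b k).1) (e₂ (c a b k).2) =
        if k < K₁ a b then expPay u (e₁ p.1) (e₂ p.2) else expPay u (e₁ p'.1) (e₂ p'.2) := by
      intro k hk
      simp only [c, if_pos (Finset.mem_range.1 hk)]
      split_ifs <;> rfl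
    have E₂ : ∀ k ∈ range L, expPay u (e₁ (c a b (L + k)).1) (e₂ (c a b (L + k)).2) =
        if k < K₂ a b then expPay u (e₁ q.1) (e₂ q.2) else expPay u (e₁ q'.1) (e₂ q'.2) := by
      intro k _
      simp only [c, Nat.not_lt.2 (Nat.le_add_right L k), if_false, Nat.add_sub_cancel_left]
      split_ifs <;> rfl
    rw [Finset.sum_congr rfl E₁, Finset.sum_congr rfl E₂, sum_range_ite_lt (hL a b).1,
      sum_range_ite_lt (hL a b).2]
    ring
  refine ClassLS_of_continuation (L + L) c (fun a b k => ?_) ⟨?_, ?_⟩ hN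
  · simp only [c]
    split_ifs <;> assumption
  · refine hs.of_add_const
      (c := -(L * expPay u₁ (e₁ p'.1) (e₂ p'.2) + L * expPay u₁ (e₁ q'.1) (e₂ q'.2)))
      fun a b => ?_
    rw [pay]; ring
  · refine ht.of_add_const
      (c := -(L * expPay u₂ (e₁ p'.1) (e₂ p'.2) + L * expPay u₂ (e₁ q'.1) (e₂ q'.2)))
      fun a b => ?_
    rw [pay]; ring

end StrategyClass

section BestResponsePolytope

/-- A ray leaving a point of a polyhedron against some constraint hits a new constraint. -/
lemma exists_first_hit {J : Type*} [Fintype J] (α β : J → ℝ) (hα : ∀ j, 0 ≤ α j)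
    (hβ : ∀ j, α j = 0 → β j = 0) (hneg : ∃ j, β j < 0) :
    ∃ t, 0 ≤ t ∧ (∀ j, 0 ≤ α j + t * β j) ∧ ∃ j, α j ≠ 0 ∧ α j + t * β j = 0 := by
  classical
  obtain ⟨j₀, hj₀⟩ := hneg
  obtain ⟨j, hj, hmin⟩ := Finset.exists_min_image (Finset.univ.filter fun j => β j < 0)
    (fun j => α j / (-β j)) ⟨j₀, by simpa using hj₀⟩
  simp only [Finset.mem_filter, Finset.mem_univ, true_and] at hj hmin
  have ht : 0 ≤ α j / (-β j) := div_nonneg (hα j) (by linarith)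
  refine ⟨α j / (-β j), ht, fun i => ?_, j, fun h => hj.ne (hβ j h), ?_⟩
  · rcases lt_or_ge (β i) 0 with hi | hi
    · have := hmin i hi
      rw [le_div_iff₀ (by linarith)] at this
      linarith
    · have := mul_nonneg ht hi
      linarith [hα i]
  · have := hj.ne
    field_simp
    ring

variable {A₁ A₂ : Type*} [Fintype A₁]

/-- The constraints defining the mixed strategies of player 1 to which `b₀` is a best response. -/
def slack (u : A₁ → A₂ → ℝ) (b₀ : A₂) : (A₁ → ℝ) →ₗ[ℝ] (A₁ ⊕ A₂ → ℝ) where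
  toFun d := Sum.elim d fun b => ∑ a, d a * (u a b₀ - u a b)
  map_add' d d' := by
    funext j
    cases j <;> simp [add_mul, Finset.sum_add_distrib]
  map_smul' c d := by
    funext j
    cases j <;> simp [mul_assoc, Finset.mul_sum]

lemma slack_inr (u : A₁ → A₂ → ℝ) (b₀ : A₂) (d : A₁ → ℝ) (b : A₂) :
    slack u b₀ d (Sum.inr b) = ∑ a, d a * u a b₀ - ∑ a, d a * u a b := by
  simp [slack, mul_sub]

variable [Fintype A₂]

open scoped Classical in
/-- If fewer constraints are tight than there are actions, one can move along the tight ones. -/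
lemma exists_direction (u : A₁ → A₂ → ℝ) (b₀ : A₂) (f p : A₁ → ℝ)
    (hcard : (Finset.univ.filter fun j => slack u b₀ p j = 0).card < Fintype.card A₁) :
    ∃ d : A₁ → ℝ, d ≠ 0 ∧ ∑ a, d a = 0 ∧ (∀ j, slack u b₀ p j = 0 → slack u b₀ d j = 0) ∧
      ∑ a, d a * f a ≤ 0 := by
  suffices H : ∃ d : A₁ → ℝ, d ≠ 0 ∧ ∑ a, d a = 0 ∧
      ∀ j, slack u b₀ p j = 0 → slack u b₀ d j = 0 by
    obtain ⟨d, h₀, h₁, h₂⟩ := H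
    rcases le_total (∑ a, d a * f a) 0 with h | h
    · exact ⟨d, h₀, h₁, h₂, h⟩
    · refine ⟨-d, neg_ne_zero.2 h₀, by simpa using h₁, fun j hj => ?_, by simpa using h⟩
      rw [map_neg, Pi.neg_apply, h₂ j hj, neg_zero]
  let Λ : (A₁ → ℝ) →ₗ[ℝ] ({j // slack u b₀ p j = 0} → ℝ) :=
    { toFun := fun d j => if j.1 = Sum.inr b₀ then ∑ a, d a else slack u b₀ d j.1
      map_add' := fun d d' => by
        funext j
        simp only [map_add, Pi.add_apply, Finset.sum_add_distrib]
        split_ifs <;> rfl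
      map_smul' := fun c d => by
        funext j
        simp only [map_smul, Pi.smul_apply, smul_eq_mul, ← Finset.mul_sum, RingHom.id_apply]
        split_ifs <;> rfl }
  have hker : LinearMap.ker Λ ≠ ⊥ := by
    apply LinearMap.ker_ne_bot_of_finrank_lt
    rw [Module.finrank_fintype_fun_eq_card, Module.finrank_fintype_fun_eq_card,
      Fintype.card_subtype]
    exact hcard
  obtain ⟨d, hd, hd₀⟩ := Submodule.exists_mem_ne_zero_of_ne_bot hker
  rw [LinearMap.mem_ker] at hd
  refine ⟨d, hd₀, ?_, fun j hj => ?_⟩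
  · have := congrFun hd ⟨Sum.inr b₀, by simp [slack]⟩
    simpa [Λ] using this
  · by_cases h : j = Sum.inr b₀
    · subst h
      simp [slack]
    · have := congrFun hd ⟨j, hj⟩
      simpa [Λ, h] using this

open scoped Classical in
/-- Among the strategies to which `b₀` is a best response and which satisfy a strict linear
inequality, some strategy has at least as many best responses as support points. -/
lemma exists_card_support_le (u : A₁ → A₂ → ℝ) (b₀ : A₂) (f : A₁ → ℝ) (c : ℝ) (σ : Mix A₁)
    (hbr : ∀ b, ∑ a, σ.p a * u a b ≤ ∑ a, σ.p a * u a b₀) (hlt : ∑ a, σ.p a * f a < c) :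
    ∃ ρ : Mix A₁, (∀ b, ∑ a, ρ.p a * u a b ≤ ∑ a, ρ.p a * u a b₀) ∧ ∑ a, ρ.p a * f a < c ∧
      Fintype.card {a // ρ.p a ≠ 0} ≤
        Fintype.card {b // ∑ a, ρ.p a * u a b = ∑ a, ρ.p a * u a b₀} := by
  induction hn : Fintype.card (A₁ ⊕ A₂) -
    (Finset.univ.filter fun j => slack u b₀ σ.p j = 0).card using Nat.strong_induction_on
    generalizing σ with
  | _ n ih =>
  rcases le_or_gt (Fintype.card A₁) (Finset.univ.filter fun j => slack u b₀ σ.p j = 0).card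
    with hcard | hcard
  · refine ⟨σ, hbr, hlt, ?_⟩
    have e : (Finset.univ.filter fun j => slack u b₀ σ.p j = 0).card =
        Fintype.card {a // σ.p a = 0} +
          Fintype.card {b // ∑ a, σ.p a * u a b = ∑ a, σ.p a * u a b₀} := by
      rw [← Fintype.card_subtype, ← Fintype.card_sum]
      refine Fintype.card_congr (Equiv.subtypeSum.trans (Equiv.sumCongr (Equiv.refl _) ?_))
      exact Equiv.subtypeEquivRight fun b => by rw [slack_inr, sub_eq_zero, eq_comm]
    have := Fintype.card_subtype_compl fun a => σ.p a = 0
    have h := Fintype.card_subtype_le fun a => σ.p a = 0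
    simp only [ne_eq]
    omega
  · obtain ⟨d, hd₀, hd₁, hd₂, hdf⟩ := exists_direction u b₀ f σ.p hcard
    have hneg : ∃ a, d a < 0 := by
      by_contra! h
      exact hd₀ (funext fun a =>
        (Finset.sum_eq_zero_iff_of_nonneg fun a _ => h a).1 hd₁ a (Finset.mem_univ a))
    have hnn : ∀ j, 0 ≤ slack u b₀ σ.p j := by
      rintro (a | b)
      · exact σ.nonneg a
      · rw [slack_inr]
        linarith [hbr b]
    obtain ⟨a₀, ha₀⟩ := hneg
    obtain ⟨t, ht, hnn', j, hj, hj'⟩ := exists_first_hit _ _ hnn hd₂ ⟨Sum.inl a₀, ha₀⟩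
    have hlin : ∀ j, slack u b₀ (fun a => σ.p a + t * d a) j =
        slack u b₀ σ.p j + t * slack u b₀ d j := by
      intro j
      have : (fun a => σ.p a + t * d a) = σ.p + t • d := rfl
      rw [this, map_add, map_smul]
      rfl
    let ρ : Mix A₁ :=
      { p := fun a => σ.p a + t * d a
        nonneg := fun a => hnn' (Sum.inl a)
        sum_one := by rw [Finset.sum_add_distrib, ← Finset.mul_sum, hd₁, σ.sum_one]; simp }
    refine ih _ ?_ ρ (fun b => ?_) ?_ rfl
    · have hlt : (Finset.univ.filter fun j => slack u b₀ σ.p j = 0).card <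
          (Finset.univ.filter fun j => slack u b₀ ρ.p j = 0).card := by
        apply Finset.card_lt_card
        rw [Finset.ssubset_iff_of_subset]
        · exact ⟨j, by simp [ρ, hlin, hj'], by simp [hj]⟩
        · intro i hi
          simp only [Finset.mem_filter, Finset.mem_univ, true_and] at hi ⊢
          simp only [ρ, hlin, hi, hd₂ i hi]
          simp
      have hle := Finset.card_le_univ (Finset.univ.filter fun j => slack u b₀ ρ.p j = 0)
      omega
    · have := hnn' (Sum.inr b)
      rw [← hlin, slack_inr] at this
      exact sub_nonneg.1 this
    · have : ∑ a, ρ.p a * f a = ∑ a, σ.p a * f a + t * ∑ a, d a * f a := by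
        simp only [ρ, add_mul, Finset.sum_add_distrib, Finset.mul_sum, mul_assoc]
      rw [this]
      have := mul_nonpos_of_nonneg_of_nonpos ht hdf
      linarith

/-- Weights, concentrated near `i₀`, that equalize the rows of a matrix with large multiples of
`γ` added on the diagonal. -/
lemma exists_equalizing_weights {ι κ : Type*} [Fintype ι] [DecidableEq ι] [Finite κ] (i₀ : ι)
    (E : ι → ι → ℝ) {γ : ℝ} (hγ : 0 < γ) (F : κ → ι → ℝ) (g : ι → ℝ) (hg : g i₀ < 0) :
    ∃ (k : ι → ℕ) (W : ι → ℝ) (C : ℝ), (∀ j, 0 < W j) ∧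
      (∀ i, ∑ j, W j * E i j + W i * (k i * γ) = C) ∧
      (∀ a, ∑ j, W j * F a j ≤ C) ∧ ∑ j, W j * g j < 0 := by
  let v : ι → ℝ → ℝ := fun j s => if j = i₀ then 1 else s
  let M : ℝ → Matrix ι ι ℝ := fun s => 1 + Matrix.of fun i j => E i j * (s * v j s) / γ
  let x : ℝ → ι → ℝ := fun s => (M s).adjugate.mulVec 1
  have hv : ∀ j, Continuous (v j) := by
    intro j
    by_cases h : j = i₀
    · simp only [v, h, if_true]; exact continuous_const
    · simp only [v, h, if_false]; exact continuous_id
  have hM : Continuous M := by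
    refine continuous_const.add (continuous_matrix fun i j => ?_)
    have := hv j
    simp only [Matrix.of_apply]
    fun_prop
  have hx : Continuous x := hM.matrix_adjugate.matrix_mulVec continuous_const
  have hxj : ∀ j, Continuous fun s => x s j := fun j => (continuous_apply j).comp hx
  have hM₀ : M 0 = 1 := by
    simp only [M, zero_mul, mul_zero, zero_div]
    ext i j
    simp
  have hx₀ : ∀ j, x 0 j = 1 := by
    intro j
    simp [x, hM₀]
  have ev₁ : ∀ᶠ s in nhds (0 : ℝ), ∀ j, 0 < x s j :=
    Filter.eventually_all.2 fun j =>
      (hxj j).continuousAt.eventually_const_lt (by simp [hx₀])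
  have ev₂ : ∀ᶠ s in nhds (0 : ℝ), ∀ a, ∑ j, s * v j s * x s j * F a j < γ * (M s).det :=
    Filter.eventually_all.2 fun a => by
      refine ContinuousAt.eventually_lt (Continuous.continuousAt ?_) (Continuous.continuousAt ?_) ?_
      · fun_prop
      · exact continuous_const.mul hM.matrix_det
      · simpa [hM₀] using hγ
  have ev₃ : ∀ᶠ s in nhds (0 : ℝ), ∑ j, v j s * x s j * g j < 0 := by
    refine ContinuousAt.eventually_lt (Continuous.continuousAt ?_) continuousAt_const ?_
    · fun_prop
    · simpa [hx₀, v] using hg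
  obtain ⟨n, h₁, h₂, h₃⟩ :=
    (tendsto_one_div_add_atTop_nhds_zero_nat.eventually (ev₁.and (ev₂.and ev₃))).exists
  set s : ℝ := 1 / ((n : ℝ) + 1) with hs
  have hs₀ : 0 < s := by positivity
  have hvs : ∀ j, 0 < v j s := by
    intro j
    simp only [v]
    split_ifs
    exacts [one_pos, hs₀]
  refine ⟨fun i => if i = i₀ then n + 1 else (n + 1) ^ 2, fun j => s * v j s * x s j,
    γ * (M s).det, fun j => mul_pos (mul_pos hs₀ (hvs j)) (h₁ j), fun i => ?_,
    fun a => (h₂ a).le, ?_⟩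
  · have hrow : ((M s).mulVec (x s)) i = (M s).det := by
      simp only [x, Matrix.mulVec_mulVec, Matrix.mul_adjugate, Matrix.smul_mulVec]
      simp
    have hrow' : ((M s).mulVec (x s)) i = x s i + ∑ j, E i j * (s * v j s) / γ * x s j := by
      simp only [M, Matrix.add_mulVec, Matrix.one_mulVec, Pi.add_apply]
      rfl
    have hk : s * v i s * ((if i = i₀ then n + 1 else (n + 1) ^ 2 : ℕ) : ℝ) = 1 := by
      by_cases h : i = i₀
      · simp only [v, h, if_true]
        push_cast
        rw [hs]
        field_simp
      · simp only [v, h, if_false]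
        push_cast
        rw [hs]
        field_simp
    have hsum : γ * ∑ j, E i j * (s * v j s) / γ * x s j = ∑ j, s * v j s * x s j * E i j := by
      rw [Finset.mul_sum]
      refine Finset.sum_congr rfl fun j _ => ?_
      field_simp
    rw [← hrow, hrow', mul_add, hsum]
    linear_combination x s i * γ * hk
  · have : ∑ j, s * v j s * x s j * g j = s * ∑ j, v j s * x s j * g j := by
      simp only [Finset.mul_sum, mul_assoc]
    rw [this]
    exact mul_neg_of_pos_of_neg hs₀ h₃

open scoped Classical in
/-- The mixed strategy obtained by pushing forward and normalizing positive weights. -/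
lemma exists_mix_of_weights {ι : Type*} [Fintype ι] [Nonempty ι] {A : Type*} [Fintype A] (e : ι → A)
    {W : ι → ℝ} (hW : ∀ j, 0 < W j) :
    ∃ τ : Mix A, ∀ f : A → ℝ, ∑ b, τ.p b * f b = (∑ j, W j * f (e j)) / ∑ j, W j := by
  have hS : 0 < ∑ j, W j := Finset.sum_pos (fun j _ => hW j) Finset.univ_nonempty
  have key : ∀ f : A → ℝ, ∑ b, (∑ j, if e j = b then W j else 0) / (∑ j, W j) * f b =
      (∑ j, W j * f (e j)) / ∑ j, W j := by
    intro f
    simp only [div_mul_eq_mul_div, ← Finset.sum_div, Finset.sum_mul]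
    rw [Finset.sum_comm]
    simp [ite_mul]
  refine ⟨⟨fun b => (∑ j, if e j = b then W j else 0) / ∑ j, W j, fun b => ?_, ?_⟩, key⟩
  · exact div_nonneg (Finset.sum_nonneg fun j _ => by split_ifs <;> simp [(hW j).le]) hS.le
  · have := key fun _ => 1
    simpa [hS.ne'] using this

/-- If player 2 best responds but player 1 does not, then some profile with this property becomes
a best response for player 1 after adding suitable multiples of `γ` to the payoffs. -/
lemma exists_BR1m_with_rewards [DecidableEq A₁] [DecidableEq A₂] {u₁ u₂ : A₁ → A₂ → ℝ} {γ : ℝ}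
    (hγ : 0 < γ) {σ : Mix A₁} {τ : Mix A₂} (hbr : BR2m u₂ σ τ) (hn : ¬ BR1m u₁ σ τ) :
    ∃ (ρ : Mix A₁) (υ : Mix A₂) (K : A₁ → A₂ → ℕ),
      BR1m (fun a b => u₁ a b + K a b * γ) ρ υ ∧ BR2m u₂ ρ υ ∧ ¬ BR1m u₁ ρ υ := by
  rw [BR1m_iff_pure] at hn
  push Not at hn
  obtain ⟨a', ha'⟩ := hn
  obtain ⟨b₀, hb₀, hpos⟩ : ∃ b, ∑ a, σ.p a * u₁ a b < u₁ a' b ∧ 0 < τ.p b := by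
    rw [expPay_pure_left, expPay_eq_sum_right] at ha'
    obtain ⟨b, -, hb⟩ := Finset.exists_lt_of_sum_lt ha'
    have hb₀ : 0 < τ.p b := (τ.nonneg b).lt_of_ne fun h => by simp [← h] at hb
    exact ⟨b, lt_of_mul_lt_mul_left hb hb₀.le, hb₀⟩
  have hbr₀ : ∀ b, ∑ a, σ.p a * u₂ a b ≤ ∑ a, σ.p a * u₂ a b₀ := by
    rw [BR2m_iff_pure] at hbr
    simp only [expPay_pure_right] at hbr
    have hz : ∑ b, τ.p b * (expPay u₂ σ τ - ∑ a, σ.p a * u₂ a b) = 0 := by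
      simp only [mul_sub, Finset.sum_sub_distrib, ← Finset.sum_mul, τ.sum_one, one_mul]
      rw [expPay_eq_sum_right, sub_self]
    have := (Finset.sum_eq_zero_iff_of_nonneg fun b _ =>
      mul_nonneg (τ.nonneg b) (sub_nonneg.2 (hbr b))).1 hz b₀ (Finset.mem_univ _)
    have := (mul_eq_zero.1 this).resolve_left hpos.ne'
    intro b
    linarith [hbr b]
  classical
  obtain ⟨ρ, hρbr, hρlt, hcard⟩ := exists_card_support_le u₂ b₀ (fun a => u₁ a b₀) (u₁ a' b₀) σ
    hbr₀ hb₀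
  obtain ⟨i₀⟩ : Nonempty {a // ρ.p a ≠ 0} := by
    by_contra h
    rw [not_nonempty_iff, isEmpty_subtype] at h
    have := ρ.sum_one
    simp [not_not.1 (h _)] at this
  obtain ⟨e, he, he₀, hinj⟩ : ∃ e : {a // ρ.p a ≠ 0} → A₂,
      (∀ i, ∑ a, ρ.p a * u₂ a (e i) = ∑ a, ρ.p a * u₂ a b₀) ∧ e i₀ = b₀ ∧
        Function.Injective e := by
    obtain ⟨ε⟩ := Function.Embedding.nonempty_of_card_le hcard
    let w := Equiv.swap (ε i₀) ⟨b₀, rfl⟩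
    exact ⟨fun i => (w (ε i)).1, fun i => (w (ε i)).2, by simp [w],
      Subtype.val_injective.comp (w.injective.comp ε.injective)⟩
  obtain ⟨k, W, C, hW, hEq, hF, hg⟩ := exists_equalizing_weights i₀ (fun i j => u₁ i.1 (e j)) hγ
    (fun a j => u₁ a (e j)) (fun j => ∑ a, ρ.p a * u₁ a (e j) - u₁ a' (e j))
    (by rw [he₀]; linarith)
  have : Nonempty {a // ρ.p a ≠ 0} := ⟨i₀⟩
  obtain ⟨υ, hυ⟩ := exists_mix_of_weights e hW
  have hS : 0 < ∑ j, W j := Finset.sum_pos (fun j _ => hW j) Finset.univ_nonempty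
  let K : A₁ → A₂ → ℕ := fun a b =>
    if h : ρ.p a ≠ 0 then if b = e ⟨a, h⟩ then k ⟨a, h⟩ else 0 else 0
  have pay_supp : ∀ a, ρ.p a ≠ 0 →
      ∑ b, υ.p b * (u₁ a b + K a b * γ) = C / ∑ j, W j := by
    intro a ha
    rw [hυ, ← hEq ⟨a, ha⟩]
    congr 1
    simp only [mul_add, Finset.sum_add_distrib]
    congr 1
    rw [Finset.sum_eq_single ⟨a, ha⟩]
    · simp [K, ha]
    · intro j _ hj
      simp [K, ha, hinj.eq_iff, hj]
    · simp
  have pay_le : ∀ a, ∑ b, υ.p b * (u₁ a b + K a b * γ) ≤ C / ∑ j, W j := by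
    intro a
    by_cases ha : ρ.p a ≠ 0
    · exact (pay_supp a ha).le
    · rw [hυ]
      refine div_le_div_of_nonneg_right (le_trans (le_of_eq ?_) (hF a)) hS.le
      simp [K, not_not.1 ha]
  refine ⟨ρ, υ, K, ?_, ?_, fun h => ?_⟩
  · rw [BR1m_iff_pure]
    intro a
    have : expPay (fun a b => u₁ a b + K a b * γ) ρ υ = C / ∑ j, W j := by
      rw [expPay_eq_sum_left, ← one_mul (C / _), ← ρ.sum_one, Finset.sum_mul]
      refine Finset.sum_congr rfl fun a _ => ?_
      by_cases ha : ρ.p a = 0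
      · simp [ha]
      · rw [pay_supp a ha]
    rw [this, expPay_pure_left]
    exact pay_le a
  · rw [BR2m_iff_pure]
    intro b
    rw [expPay_pure_right, expPay_eq_sum_right, hυ]
    simp only [he]
    rw [← Finset.sum_mul, mul_div_cancel_left₀ _ hS.ne']
    exact hρbr b
  · have := h (Mix.pure a')
    rw [expPay_pure_left, expPay_eq_sum_right, hυ, hυ, div_le_div_iff_of_pos_right hS] at this
    simp only [mul_sub, Finset.sum_sub_distrib] at hg
    linarith

end BestResponsePolytope

section Characterization

variable {A₁ A₂ S₁ S₂ : Type*} [Fintype A₁] [Fintype A₂]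

lemma oneVal_or_nontrivial {V : Set ℝ} (hV : V.Nonempty) : oneVal V ∨ V.Nontrivial := by
  rcases V.subsingleton_or_nontrivial with h | h
  · obtain ⟨v, hv⟩ := hV
    exact Or.inl ⟨v, h.eq_singleton_of_mem hv⟩
  · exact Or.inr h

lemma not_nontrivial_of_oneVal {V : Set ℝ} (hV : oneVal V) : ¬ V.Nontrivial := by
  obtain ⟨v, rfl⟩ := hV
  exact Set.not_nontrivial_singleton

/-- The payoffs that `u` takes on the equilibria in the given strategy classes. -/
def ClassValues (e₁ : S₁ → Mix A₁) (e₂ : S₂ → Mix A₂) (u₁ u₂ u : A₁ → A₂ → ℝ) : Set ℝ :=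
  {v | ∃ s t, ClassNash e₁ e₂ u₁ u₂ s t ∧ expPay u (e₁ s) (e₂ t) = v}

lemma ClassLS.cases [Nonempty A₁] [Nonempty A₂] {e₁ : S₁ → Mix A₁} {e₂ : S₂ → Mix A₂}
    {u₁ u₂ : A₁ → A₂ → ℝ} (H : ClassLS e₁ e₂ u₁ u₂) :
    ((ClassValues e₁ e₂ u₁ u₂ u₁).Nontrivial ∧ (ClassValues e₁ e₂ u₁ u₂ u₂).Nontrivial ∧
      ∃ s t, ¬ ClassNash e₁ e₂ u₁ u₂ s t) ∨
    ((ClassValues e₁ e₂ u₁ u₂ u₁).Nontrivial ∧ oneVal (ClassValues e₁ e₂ u₁ u₂ u₂) ∧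
      ∃ s t, ¬ ClassBR1 e₁ e₂ u₁ s t ∧ ClassBR2 e₁ e₂ u₂ s t) ∨
    (oneVal (ClassValues e₁ e₂ u₁ u₂ u₁) ∧ (ClassValues e₁ e₂ u₁ u₂ u₂).Nontrivial ∧
      ∃ s t, ¬ ClassBR2 e₁ e₂ u₂ s t ∧ ClassBR1 e₁ e₂ u₁ s t) := by
  obtain ⟨s, t, hst⟩ := H.exists_nash
  have const : ∀ {u : A₁ → A₂ → ℝ}, oneVal (ClassValues e₁ e₂ u₁ u₂ u) →
      ∃ v, ∀ s t, ClassNash e₁ e₂ u₁ u₂ s t → expPay u (e₁ s) (e₂ t) = v := by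
    rintro u ⟨v, hv⟩
    refine ⟨v, fun s t h => ?_⟩
    have : expPay u (e₁ s) (e₂ t) ∈ ClassValues e₁ e₂ u₁ u₂ u := ⟨s, t, h, rfl⟩
    rwa [hv] at this
  rcases oneVal_or_nontrivial (V := ClassValues e₁ e₂ u₁ u₂ u₁) ⟨_, s, t, hst, rfl⟩ with h₁ | h₁ <;>
  rcases oneVal_or_nontrivial (V := ClassValues e₁ e₂ u₁ u₂ u₂) ⟨_, s, t, hst, rfl⟩ with h₂ | h₂
  · obtain ⟨v₁, c₁⟩ := const h₁
    obtain ⟨v₂, c₂⟩ := const h₂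
    exact absurd H (not_ClassLS_of_const c₁ c₂)
  · refine Or.inr (Or.inr ⟨h₁, h₂, ?_⟩)
    obtain ⟨v, c⟩ := const h₁
    by_contra! h
    exact not_ClassLS_of_BR1_imp c (fun s t h' => by_contra fun hn => h s t hn h') H
  · refine Or.inr (Or.inl ⟨h₁, h₂, ?_⟩)
    obtain ⟨v, c⟩ := const h₂
    by_contra! h
    exact not_ClassLS_of_BR2_imp c (fun s t h' => by_contra fun hn => h s t hn h') H
  · exact Or.inl ⟨h₁, h₂, H.exists_not_nash⟩

lemma exists_nash_lt {e₁ : S₁ → Mix A₁} {e₂ : S₂ → Mix A₂} {u₁ u₂ u : A₁ → A₂ → ℝ}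
    (h : (ClassValues e₁ e₂ u₁ u₂ u).Nontrivial) : ∃ p p' : S₁ × S₂,
      ClassNash e₁ e₂ u₁ u₂ p.1 p.2 ∧ ClassNash e₁ e₂ u₁ u₂ p'.1 p'.2 ∧
      0 < expPay u (e₁ p.1) (e₂ p.2) - expPay u (e₁ p'.1) (e₂ p'.2) := by
  obtain ⟨_, ⟨s, t, h, rfl⟩, _, ⟨s', t', h', rfl⟩, hlt⟩ := h.exists_lt
  exact ⟨(s', t'), (s, t), h', h, sub_pos.2 hlt⟩

lemma expPay_eq_of_oneVal {e₁ : S₁ → Mix A₁} {e₂ : S₂ → Mix A₂} {u₁ u₂ u : A₁ → A₂ → ℝ}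
    (h : oneVal (ClassValues e₁ e₂ u₁ u₂ u)) {p p' : S₁ × S₂}
    (hp : ClassNash e₁ e₂ u₁ u₂ p.1 p.2) (hp' : ClassNash e₁ e₂ u₁ u₂ p'.1 p'.2) :
    expPay u (e₁ p.1) (e₂ p.2) = expPay u (e₁ p'.1) (e₂ p'.2) := by
  by_contra hne
  exact not_nontrivial_of_oneVal h ⟨_, ⟨_, _, hp, rfl⟩, _, ⟨_, _, hp', rfl⟩, hne⟩

lemma exists_nat_le_mul {A : Type*} [Finite A] (f : A → ℝ) {γ : ℝ} (hγ : 0 < γ) :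
    ∃ N : ℕ, ∀ a, f a ≤ N * γ := by
  obtain ⟨C, hC⟩ := (Set.finite_range f).bddAbove
  obtain ⟨N, hN⟩ := exists_nat_ge (C / γ)
  exact ⟨N, fun a => (hC ⟨a, rfl⟩).trans ((div_le_iff₀ hγ).1 hN)⟩

/-- Both players can be induced to play a given pure profile. -/
lemma ClassLS_of_pure [DecidableEq A₁] [DecidableEq A₂] {e₁ : S₁ → Mix A₁} {e₂ : S₂ → Mix A₂}
    {u₁ u₂ : A₁ → A₂ → ℝ} (h₁ : (ClassValues e₁ e₂ u₁ u₂ u₁).Nontrivial)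
    (h₂ : (ClassValues e₁ e₂ u₁ u₂ u₂).Nontrivial) {s : S₁} {t : S₂} {a : A₁} {b : A₂}
    (hs : e₁ s = Mix.pure a) (ht : e₂ t = Mix.pure b) (hN : ¬ ClassNash e₁ e₂ u₁ u₂ s t) :
    ClassLS e₁ e₂ u₁ u₂ := by
  obtain ⟨p, p', hp, hp', hlt₁⟩ := exists_nash_lt h₁
  obtain ⟨q, q', hq, hq', hlt₂⟩ := exists_nash_lt h₂
  obtain ⟨N₁, hN₁⟩ := exists_nat_le_mul (fun a' => u₁ a' b - u₁ a b) hlt₁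
  obtain ⟨N₂, hN₂⟩ := exists_nat_le_mul (fun b' => u₂ a b' - u₂ a b) hlt₂
  refine ClassLS_of_rewards hp hp' hq hq' (fun a' _ => if a' = a then N₁ else 0)
    (fun _ b' => if b' = b then N₂ else 0) (fun s' => ?_) (fun t' => ?_) hN
  · rw [hs, ht, expPay_pure_pure, expPay_pure_right]
    refine (e₁ s').sum_mul_le fun a' => ?_
    by_cases h : a' = a
    · rw [h]
    · simp only [h, if_true, if_false, Nat.cast_zero, zero_mul]
      linarith [hN₁ a']
  · rw [hs, ht, expPay_pure_pure, expPay_pure_left]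
    refine (e₂ t').sum_mul_le fun b' => ?_
    by_cases h : b' = b
    · rw [h]
    · simp only [h, if_true, if_false, Nat.cast_zero, zero_mul]
      linarith [hN₂ b']

lemma ClassLS_of_rewards_left {e₁ : S₁ → Mix A₁} {e₂ : S₂ → Mix A₂} {u₁ u₂ : A₁ → A₂ → ℝ}
    (h₁ : (ClassValues e₁ e₂ u₁ u₂ u₁).Nontrivial) (h₂ : oneVal (ClassValues e₁ e₂ u₁ u₂ u₂))
    (H : ∀ γ : ℝ, 0 < γ → ∃ (s : S₁) (t : S₂) (K : A₁ → A₂ → ℕ),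
      ClassBR1 e₁ e₂ (fun a b => u₁ a b + K a b * γ) s t ∧ ClassBR2 e₁ e₂ u₂ s t ∧
        ¬ ClassBR1 e₁ e₂ u₁ s t) :
    ClassLS e₁ e₂ u₁ u₂ := by
  obtain ⟨p, p', hp, hp', hlt⟩ := exists_nash_lt h₁
  obtain ⟨s, t, K, hs, ht, hn⟩ := H _ hlt
  refine ClassLS_of_rewards hp hp' hp hp K 0 ?_ ?_ fun h => hn h.1
  · exact hs.of_add_const (c := 0) fun a b => by simp
  · exact ht.of_add_const (c := 0) fun a b => by simp [expPay_eq_of_oneVal h₂ hp hp']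

lemma ClassLS_of_rewards_right {e₁ : S₁ → Mix A₁} {e₂ : S₂ → Mix A₂} {u₁ u₂ : A₁ → A₂ → ℝ}
    (h₁ : oneVal (ClassValues e₁ e₂ u₁ u₂ u₁)) (h₂ : (ClassValues e₁ e₂ u₁ u₂ u₂).Nontrivial)
    (H : ∀ γ : ℝ, 0 < γ → ∃ (s : S₁) (t : S₂) (K : A₁ → A₂ → ℕ),
      ClassBR2 e₁ e₂ (fun a b => u₂ a b + K a b * γ) s t ∧ ClassBR1 e₁ e₂ u₁ s t ∧
        ¬ ClassBR2 e₁ e₂ u₂ s t) :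
    ClassLS e₁ e₂ u₁ u₂ := by
  obtain ⟨p, p', hp, hp', hlt⟩ := exists_nash_lt h₂
  obtain ⟨s, t, K, ht, hs, hn⟩ := H _ hlt
  refine ClassLS_of_rewards hp hp' hp hp K 0 ?_ ?_ fun h => hn h.2
  · exact hs.of_add_const (c := 0) fun a b => by simp [expPay_eq_of_oneVal h₁ hp hp']
  · exact ht.of_add_const (c := 0) fun a b => by simp

lemma V1mm_eq (u₁ u₂ : A₁ → A₂ → ℝ) :
    V1mm u₁ u₂ = ClassValues id id u₁ u₂ u₁ := by
  ext v
  simp only [V1mm, ClassValues, Set.mem_image, Prod.exists]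
  rfl

lemma V2mm_eq (u₁ u₂ : A₁ → A₂ → ℝ) :
    V2mm u₁ u₂ = ClassValues id id u₁ u₂ u₂ := by
  ext v
  simp only [V2mm, ClassValues, Set.mem_image, Prod.exists]
  rfl

lemma BR1m_flip {u : A₁ → A₂ → ℝ} {σ : Mix A₁} {τ : Mix A₂} :
    BR1m (fun b a => u a b) τ σ ↔ BR2m u σ τ := by
  simp only [BR1m, BR2m, expPay_flip]

lemma BR2m_flip {u : A₁ → A₂ → ℝ} {σ : Mix A₁} {τ : Mix A₂} :
    BR2m (fun b a => u a b) τ σ ↔ BR1m u σ τ := by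
  simp only [BR1m, BR2m, expPay_flip]

variable [DecidableEq A₁] [DecidableEq A₂]

lemma ClassBR1_pure_iff {u : A₁ → A₂ → ℝ} {a : A₁} {b : A₂} :
    ClassBR1 Mix.pure Mix.pure u a b ↔ BR1p u a b := by
  simp only [ClassBR1, expPay_pure_pure, BR1p]

lemma ClassBR2_pure_iff {u : A₁ → A₂ → ℝ} {a : A₁} {b : A₂} :
    ClassBR2 Mix.pure Mix.pure u a b ↔ BR2p u a b := by
  simp only [ClassBR2, expPay_pure_pure, BR2p]

lemma ClassNash_pure_iff {u₁ u₂ : A₁ → A₂ → ℝ} {a : A₁} {b : A₂} :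
    ClassNash Mix.pure Mix.pure u₁ u₂ a b ↔ (a, b) ∈ NashPP u₁ u₂ :=
  and_congr ClassBR1_pure_iff ClassBR2_pure_iff

lemma GLSpp_iff_ClassLS {u₁ u₂ : A₁ → A₂ → ℝ} :
    GLSpp u₁ u₂ ↔ ClassLS Mix.pure Mix.pure u₁ u₂ := by
  simp only [ClassLS, ClassNash_pure_iff]
  rfl

lemma V1pp_eq (u₁ u₂ : A₁ → A₂ → ℝ) :
    V1pp u₁ u₂ = ClassValues Mix.pure Mix.pure u₁ u₂ u₁ := by
  ext v
  simp [V1pp, ClassValues, ClassNash_pure_iff, expPay_pure_pure]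

lemma V2pp_eq (u₁ u₂ : A₁ → A₂ → ℝ) :
    V2pp u₁ u₂ = ClassValues Mix.pure Mix.pure u₁ u₂ u₂ := by
  ext v
  simp [V2pp, ClassValues, ClassNash_pure_iff, expPay_pure_pure]

lemma GLSpp_iff_condPP [Nonempty A₁] [Nonempty A₂] (u₁ u₂ : A₁ → A₂ → ℝ) :
    GLSpp u₁ u₂ ↔ condPP u₁ u₂ := by
  rw [GLSpp_iff_ClassLS, condPP, V1pp_eq, V2pp_eq]
  constructor
  · intro H
    rcases H.cases with ⟨h₁, h₂, s, t, h⟩ | ⟨h₁, h₂, s, t, h, h'⟩ | ⟨h₁, h₂, s, t, h, h'⟩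
    · exact Or.inl ⟨h₁, h₂, s, t, fun hn => h (ClassNash_pure_iff.2 hn)⟩
    · rw [ClassBR1_pure_iff, BR1p] at h
      push Not at h
      obtain ⟨a', ha'⟩ := h
      exact Or.inr (Or.inl ⟨h₁, h₂, s, a', t, ha', ClassBR2_pure_iff.1 h'⟩)
    · rw [ClassBR2_pure_iff, BR2p] at h
      push Not at h
      obtain ⟨b', hb'⟩ := h
      exact Or.inr (Or.inr ⟨h₁, h₂, s, t, b', hb', ClassBR1_pure_iff.1 h'⟩)
  · rintro (⟨h₁, h₂, a, b, h⟩ | ⟨h₁, h₂, a, a', b, h, h'⟩ | ⟨h₁, h₂, a, b, b', h, h'⟩)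
    · exact ClassLS_of_pure h₁ h₂ rfl rfl fun hn => h (ClassNash_pure_iff.1 hn)
    · refine ClassLS_of_rewards_left h₁ h₂ fun γ hγ => ?_
      obtain ⟨N, hN⟩ := exists_nat_le_mul (fun a' => u₁ a' b - u₁ a b) hγ
      refine ⟨a, b, fun x _ => if x = a then N else 0, ?_, ClassBR2_pure_iff.2 h', ?_⟩
      · rw [ClassBR1_pure_iff]
        intro x
        by_cases hx : x = a
        · rw [hx]
        · simp only [hx, if_true, if_false, Nat.cast_zero, zero_mul]
          linarith [hN x]
      · rw [ClassBR1_pure_iff]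
        exact fun hb => (hb a').not_gt h
    · refine ClassLS_of_rewards_right h₁ h₂ fun γ hγ => ?_
      obtain ⟨N, hN⟩ := exists_nat_le_mul (fun b' => u₂ a b' - u₂ a b) hγ
      refine ⟨a, b, fun _ y => if y = b then N else 0, ?_, ClassBR1_pure_iff.2 h', ?_⟩
      · rw [ClassBR2_pure_iff]
        intro y
        by_cases hy : y = b
        · rw [hy]
        · simp only [hy, if_true, if_false, Nat.cast_zero, zero_mul]
          linarith [hN y]
      · rw [ClassBR2_pure_iff]
        exact fun hb => (hb b').not_gt h

lemma GLSmm_iff_condMM [Nonempty A₁] [Nonempty A₂] (u₁ u₂ : A₁ → A₂ → ℝ) :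
    GLSmm u₁ u₂ ↔ condMM u₁ u₂ := by
  have e : GLSmm u₁ u₂ ↔ ClassLS id id u₁ u₂ := Iff.rfl
  rw [e, condMM, V1mm_eq, V2mm_eq]
  constructor
  · intro H
    rcases H.cases with ⟨h₁, h₂, s, t, h⟩ | ⟨h₁, h₂, s, t, h, h'⟩ | ⟨h₁, h₂, s, t, h, h'⟩
    · exact Or.inl ⟨h₁, h₂, s, t, h⟩
    · have h : ¬ BR1m u₁ s t := h
      rw [BR1m_iff_pure] at h
      push Not at h
      obtain ⟨a', ha'⟩ := h
      exact Or.inr (Or.inl ⟨h₁, h₂, s, t, a', ha', h'⟩)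
    · have h : ¬ BR2m u₂ s t := h
      rw [BR2m_iff_pure] at h
      push Not at h
      obtain ⟨b', hb'⟩ := h
      exact Or.inr (Or.inr ⟨h₁, h₂, s, t, b', hb', h'⟩)
  · rintro (⟨h₁, h₂, σ, τ, h⟩ | ⟨h₁, h₂, σ, τ, a', h, h'⟩ | ⟨h₁, h₂, σ, τ, b', h, h'⟩)
    · obtain ⟨a, b, hab⟩ : ∃ a b, (a, b) ∉ NashPP u₁ u₂ := by
        by_contra! hall
        exact h (mem_NashMM_of_forall_mem_NashPP hall σ τ)
      refine ClassLS_of_pure (s := Mix.pure a) (t := Mix.pure b) h₁ h₂ rfl rfl fun hn => hab ?_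
      exact ClassNash_pure_iff.1 ⟨fun x => hn.1 (Mix.pure x), fun y => hn.2 (Mix.pure y)⟩
    · exact ClassLS_of_rewards_left h₁ h₂ fun γ hγ =>
        exists_BR1m_with_rewards hγ h' fun hb => (hb _).not_gt h
    · refine ClassLS_of_rewards_right h₁ h₂ fun γ hγ => ?_
      obtain ⟨ρ, υ, K, k₁, k₂, k₃⟩ := exists_BR1m_with_rewards hγ
        (BR2m_flip.2 h') (fun hb => (BR1m_flip.1 hb _).not_gt h)
      exact ⟨υ, ρ, fun a b => K b a, BR1m_flip.1 k₁, BR2m_flip.1 k₂, fun hb => k₃ (BR1m_flip.2 hb)⟩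

lemma not_condMM_of_forall_mem_NashPP {u₁ u₂ : A₁ → A₂ → ℝ}
    (h : ∀ a b, (a, b) ∈ NashPP u₁ u₂) : ¬ condMM u₁ u₂ := by
  rintro (⟨-, -, σ, τ, hn⟩ | ⟨-, -, σ, τ, a', hlt, -⟩ | ⟨-, -, σ, τ, b', hlt, -⟩)
  · exact hn (mem_NashMM_of_forall_mem_NashPP h σ τ)
  · exact ((mem_NashMM_of_forall_mem_NashPP h σ τ).1 _).not_gt hlt
  · exact ((mem_NashMM_of_forall_mem_NashPP h σ τ).2 _).not_gt hlt

end Characterization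

section TwoPlayer
variable {A₁ A₂ : Type*} [Fintype A₁] [Fintype A₂] [DecidableEq A₁] [DecidableEq A₂]
variable [Nonempty A₁] [Nonempty A₂]

/-- Characterization of `𝒢_LS^{m,m} \\ 𝒢_LS^{p,p}`. -/
theorem GLSmm_diff_GLSpp_iff (u₁ u₂ : A₁ → A₂ → ℝ) :
    (¬ GLSpp u₁ u₂ ∧ GLSmm u₁ u₂) ↔
      ((V1pp u₁ u₂ = ∅ ∧ V2pp u₁ u₂ = ∅ ∧ condMM u₁ u₂) ∨
       (oneVal (V1pp u₁ u₂) ∧ oneVal (V2pp u₁ u₂) ∧ condMM u₁ u₂) ∨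
       ((V1pp u₁ u₂).Nontrivial ∧ oneVal (V2pp u₁ u₂) ∧ ¬ condPP u₁ u₂ ∧ condMM u₁ u₂) ∨
       (oneVal (V1pp u₁ u₂) ∧ (V2pp u₁ u₂).Nontrivial ∧ ¬ condPP u₁ u₂ ∧
         condMM u₁ u₂)) := by
  rw [GLSpp_iff_condPP, GLSmm_iff_condMM]
  constructor
  · rintro ⟨hP, hM⟩
    rcases (NashPP u₁ u₂).eq_empty_or_nonempty with h | h
    · exact Or.inl ⟨by simp [V1pp, h], by simp [V2pp, h], hM⟩
    · rcases oneVal_or_nontrivial (V := V1pp u₁ u₂) (h.image _) with h₁ | h₁ <;>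
      rcases oneVal_or_nontrivial (V := V2pp u₁ u₂) (h.image _) with h₂ | h₂
      · exact Or.inr (Or.inl ⟨h₁, h₂, hM⟩)
      · exact Or.inr (Or.inr (Or.inr ⟨h₁, h₂, hP, hM⟩))
      · exact Or.inr (Or.inr (Or.inl ⟨h₁, h₂, hP, hM⟩))
      · refine absurd hM (not_condMM_of_forall_mem_NashPP fun a b => by_contra fun hn => ?_)
        exact hP (Or.inl ⟨h₁, h₂, a, b, hn⟩)
  · have notPP : ¬ (V1pp u₁ u₂).Nontrivial → ¬ (V2pp u₁ u₂).Nontrivial → ¬ condPP u₁ u₂ := by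
      rintro n₁ n₂ (h | h | h)
      exacts [n₁ h.1, n₁ h.1, n₂ h.2.1]
    rintro (⟨h₁, h₂, hM⟩ | ⟨h₁, h₂, hM⟩ | ⟨-, -, h⟩ | ⟨-, -, h⟩)
    · exact ⟨notPP (by simp [h₁]) (by simp [h₂]), hM⟩
    · exact ⟨notPP (not_nontrivial_of_oneVal h₁) (not_nontrivial_of_oneVal h₂), hM⟩
    · exact h
    · exact h

end TwoPlayer
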